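/- arXiv:2106.07297 — 2 statements merged into one kernel-verified Lean document; each statement's English description precedes it below -/
import Mathlib

section
/- Full expressiveness of BoxE with classes: Let E, C, R be finite sets of entities, classes, and relations. For any disjoint sets T and F of facts over this vocabulary, there exists a BoxE configuration of dimension d = |E|·|R| + |C| in which every fact in T is true and every fact in F is false. -/
/-- A fact over a vocabulary of entities `E`, classes `C`, and relations `R`:
either a unary fact `c(e)` or a binary fact `r(e_h, e_t)`. -/
inductive BoxE.Fact (E C R : Type*) : Type _ where
  | unary  (c : C) (e : E) : BoxE.Fact E C R
  | binary (r : R) (eh et : E) : BoxE.Fact E C R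

namespace BoxE

/-- A point `p` lies in the box with lower corner `l` and upper corner `u`. -/
def inBox {d : ℕ} (l u p : Fin d → ℝ) : Prop :=
  ∀ k : Fin d, l k ≤ p k ∧ p k ≤ u k

/-- A BoxE configuration of dimension `d`: positions and bumps for entities,
a box for each class, and head and tail boxes for each relation. -/
structure Config (E C R : Type*) (d : ℕ) where
  pos   : E → Fin d → ℝ
  bump  : E → Fin d → ℝ
  clsL  : C → Fin d → ℝ
  clsU  : C → Fin d → ℝ
  headL : R → Fin d → ℝ
  headU : R → Fin d → ℝ
  tailL : R → Fin d → ℝ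
  tailU : R → Fin d → ℝ

/-- Truth of a fact in a BoxE configuration. -/
def Config.holds {E C R : Type*} {d : ℕ} (W : Config E C R d) : Fact E C R → Prop
  | .unary c e => inBox (W.clsL c) (W.clsU c) (W.pos e)
  | .binary r eh et =>
      inBox (W.headL r) (W.headU r) (W.pos eh + W.bump et) ∧
      inBox (W.tailL r) (W.tailU r) (W.pos et + W.bump eh)

end BoxE

namespace BoxE

open Classical in
/-- The configuration realizing exactly the facts in `T`. Coordinate `(a, r)` rules out the facts
`r(a, t)` not in `T`, and coordinate `c` rules out the facts `c(e)` not in `T`. -/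
noncomputable def Config.ofFacts {E C R : Type*} {d : ℕ} (σ : Fin d ≃ (E × R) ⊕ C)
    (T : Set (Fact E C R)) : Config E C R d where
  pos e k := Sum.elim (fun p => if e = p.1 then 1 else 0)
    (fun c => if Fact.unary c e ∈ T then 0 else 1) (σ k)
  bump e k := Sum.elim (fun p => if Fact.binary p.2 p.1 e ∈ T then 0 else 1) (fun _ => 0) (σ k)
  clsL _ _ := 0
  clsU c k := if σ k = Sum.inr c then 0 else 1
  headL _ _ := 0
  headU r k := Sum.elim (fun p => if p.2 = r then 1 else 2) (fun _ => 2) (σ k)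
  tailL _ _ := 0
  tailU _ _ := 2

theorem Config.holds_ofFacts {E C R : Type*} {d : ℕ} (σ : Fin d ≃ (E × R) ⊕ C)
    (T : Set (Fact E C R)) (f : Fact E C R) : (Config.ofFacts σ T).holds f ↔ f ∈ T := by
  cases f with
  | unary c e =>
    simp only [Config.holds, inBox, Config.ofFacts, σ.forall_congr_left, Equiv.apply_symm_apply]
    constructor
    · intro h
      by_contra hT
      have := (h (Sum.inr c)).2
      norm_num [hT] at this
    · rintro hT (⟨a, r⟩ | c')
      · simp only [Sum.elim_inl]
        split_ifs <;> simp_all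
      · simp only [Sum.elim_inr]
        split_ifs <;> simp_all
  | binary r h t =>
    simp only [Config.holds, inBox, Config.ofFacts, Pi.add_apply, σ.forall_congr_left,
      Equiv.apply_symm_apply]
    constructor
    · rintro ⟨hh, -⟩
      by_contra hT
      have := (hh (Sum.inl (h, r))).2
      norm_num [hT] at this
    · refine fun hT => ⟨?_, ?_⟩
      · rintro (⟨a, r'⟩ | c)
        · simp only [Sum.elim_inl]
          split_ifs <;> first | (norm_num; done) | simp_all
        · simp only [Sum.elim_inr]
          split_ifs <;> norm_num
      · rintro (⟨a, r'⟩ | c)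
        · simp only [Sum.elim_inl]
          split_ifs <;> norm_num
        · simp only [Sum.elim_inr]
          split_ifs <;> norm_num

end BoxE

/-- **full expressiveness of BoxE with classes.**
For finite sets `E`, `C`, `R` of entities, classes, and relations and any
disjoint sets `T` and `F` of facts, there is a BoxE configuration of
dimension `d = |E|·|R| + |C|` making every fact of `T` true and every fact
of `F` false. -/
theorem boxe_fully_expressive_with_classes
    {E C R : Type*} [Fintype E] [Fintype C] [Fintype R]
    (T F : Set (BoxE.Fact E C R)) (hTF : Disjoint T F) :
    ∃ W : BoxE.Config E C R (Fintype.card E * Fintype.card R + Fintype.card C),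
      (∀ f ∈ T, W.holds f) ∧ (∀ f ∈ F, ¬ W.holds f) := by
  let σ : Fin (Fintype.card E * Fintype.card R + Fintype.card C) ≃ (E × R) ⊕ C :=
    (Fintype.equivFinOfCardEq (by simp)).symm
  exact ⟨.ofFacts σ T, fun f hf => (BoxE.Config.holds_ofFacts σ T f).2 hf,
    fun f hf h => hTF.notMem_of_mem_left ((BoxE.Config.holds_ofFacts σ T f).1 h) hf⟩
end

section
/- Dimension padding preserves fact truth values: Let W be a BoxE configuration of dimension d over finite sets E, C, R of entities, classes, and relations, and let W' be a configuration of dimension d + m obtained from W as follows: each entity's position is extended by arbitrary new coordinates p(e) ∈ ℝ^m, each entity's bump vector is extended by the zero vector in ℝ^m, and each class box, relation head box, and relation tail box is extended in the new m coordinates by intervals that contain p(e)(k) for every entity e and every new coordinate k. Then every fact (unary or binary) is true in W' if and only if it is true in W. -/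
namespace BoxE

/-- Membership in a product of boxes is membership in both factors. -/
theorem inBox_append {d m : ℕ} (l u p : Fin d → ℝ) (l' u' p' : Fin m → ℝ) :
    inBox (Fin.append l l') (Fin.append u u') (Fin.append p p') ↔
      inBox l u p ∧ inBox l' u' p' := by
  simp [inBox, Fin.forall_fin_add]

end BoxE

/-- Adding appended vectors is done blockwise. -/
theorem Fin.append_add_append {d m : ℕ} {α : Type*} [Add α] (a b : Fin d → α)
    (a' b' : Fin m → α) :
    Fin.append a a' + Fin.append b b' = Fin.append (a + b) (a' + b') := by
  ext k
  refine Fin.addCases (fun i => ?_) (fun i => ?_) k <;> simp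

/-- **dimension padding preserves fact truth values.**
Extend a configuration `W` of dimension `d` to dimension `d + m` by appending
arbitrary new position coordinates `p e`, zero bump coordinates, and boxes
whose new coordinates span intervals containing `p e k` for every entity `e`
and new coordinate `k`. Then every fact is true in the extended configuration
`W'` iff it is true in `W`. -/
theorem boxe_padding_preserves_truth
    {E C R : Type*} [Fintype E] [Fintype C] [Fintype R]
    {d m : ℕ} (W : BoxE.Config E C R d)
    (p : E → Fin m → ℝ)
    (cL cU : C → Fin m → ℝ)
    (hL hU tL tU : R → Fin m → ℝ)
    (hcls : ∀ (c : C) (e : E) (k : Fin m), cL c k ≤ p e k ∧ p e k ≤ cU c k)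
    (hhead : ∀ (r : R) (e : E) (k : Fin m), hL r k ≤ p e k ∧ p e k ≤ hU r k)
    (htail : ∀ (r : R) (e : E) (k : Fin m), tL r k ≤ p e k ∧ p e k ≤ tU r k)
    (W' : BoxE.Config E C R (d + m))
    (hpos : ∀ e, W'.pos e = Fin.append (W.pos e) (p e))
    (hbump : ∀ e, W'.bump e = Fin.append (W.bump e) 0)
    (hclsL : ∀ c, W'.clsL c = Fin.append (W.clsL c) (cL c))
    (hclsU : ∀ c, W'.clsU c = Fin.append (W.clsU c) (cU c))
    (hheadL : ∀ r, W'.headL r = Fin.append (W.headL r) (hL r))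
    (hheadU : ∀ r, W'.headU r = Fin.append (W.headU r) (hU r))
    (htailL : ∀ r, W'.tailL r = Fin.append (W.tailL r) (tL r))
    (htailU : ∀ r, W'.tailU r = Fin.append (W.tailU r) (tU r)) :
    ∀ f : BoxE.Fact E C R, W'.holds f ↔ W.holds f := by
  rintro (⟨c, e⟩ | ⟨r, eh, et⟩)
  · simp only [BoxE.Config.holds, hpos, hclsL, hclsU, BoxE.inBox_append]
    exact and_iff_left (hcls c e)
  · simp only [BoxE.Config.holds, hpos, hbump, hheadL, hheadU, htailL, htailU,
      Fin.append_add_append, add_zero, BoxE.inBox_append]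
    exact and_congr (and_iff_left (hhead r eh)) (and_iff_left (htail r et))
end
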